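/- (Morawetz estimate) Let d ≥ 4 and let u be a radial classical solution of the defocusing conformal nonlinear wave equation on [0, T] × ℝ^d for some T > 0. Then there is a constant C depending only on d such that ∫_0^T ∫_{ℝ^d} [ u(t,x)²/|x|³ + |u(t,x)|^{2(d+1)/(d−1)}/|x| ] dx dt ≤ C sup_{t ∈ [0, T]} ( ‖∇u(t)‖_{L²(ℝ^d)}² + ‖∂_t u(t)‖_{L²(ℝ^d)}² ). -/

import Mathlib

noncomputable section

open MeasureTheory Real Set
open scoped ENNReal RealInnerProductSpace

/-- Euclidean space `ℝ^d`. -/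
abbrev Euc (d : ℕ) := EuclideanSpace ℝ (Fin d)

/-- The time derivative `∂ₜ u` of a function `u : ℝ × ℝ^d → ℝ` (in curried form). -/
def timeDeriv (d : ℕ) (u : ℝ → Euc d → ℝ) (t : ℝ) (x : Euc d) : ℝ :=
  deriv (fun s => u s x) t

/-- The second time derivative `∂ₜ² u`. -/
def timeDeriv2 (d : ℕ) (u : ℝ → Euc d → ℝ) (t : ℝ) (x : Euc d) : ℝ :=
  deriv (deriv (fun s => u s x)) t

/-- The spatial Laplacian `Δf = ∑ⱼ ∂²f/∂xⱼ²`. -/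
def spatialLap (d : ℕ) (f : Euc d → ℝ) (x : Euc d) : ℝ :=
  ∑ i : Fin d,
    fderiv ℝ (fun y => fderiv ℝ f y (EuclideanSpace.single i 1)) x (EuclideanSpace.single i 1)

/-- A function on `ℝ^d` is radial if it depends only on `|x|`. -/
def IsRadial (d : ℕ) (f : Euc d → ℝ) : Prop := ∃ g : ℝ → ℝ, ∀ x, f x = g ‖x‖

/-- A classical solution of the defocusing conformal nonlinear wave equation
`∂ₜ²u − Δu + |u|^{4/(d−1)} u = 0`: a smooth function satisfying the equation pointwise,
whose time slices `u(t, ⬝)` and `∂ₜu(t, ⬝)` are (smooth and) compactly supported. -/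
def IsClassicalSolution (d : ℕ) (u : ℝ → Euc d → ℝ) : Prop :=
  ContDiff ℝ (⊤ : ℕ∞) (Function.uncurry u) ∧
  (∀ t, HasCompactSupport (u t)) ∧
  (∀ t, HasCompactSupport (fun x => timeDeriv d u t x)) ∧
  (∀ t x, timeDeriv2 d u t x - spatialLap d (u t) x
      + |u t x| ^ ((4 : ℝ) / ((d : ℝ) - 1)) * u t x = 0)

/-- The homogeneous Sobolev norm `‖f‖_{Ḣ^s} = (∫ |ξ|^{2s} |f̂(ξ)|² dξ)^{1/2}`,
valued in `[0, ∞]`. -/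
def sobolevNorm (d : ℕ) (s : ℝ) (f : Euc d → ℝ) : ℝ≥0∞ :=
  (∫⁻ ξ : Euc d,
    ENNReal.ofReal (‖ξ‖ ^ (2 * s) * ‖FourierTransform.fourier (fun x => (f x : ℂ)) ξ‖ ^ 2)) ^
    ((1 : ℝ) / 2)

/-- The space-time Lebesgue norm `‖u‖_{L^r_{t,x}(ℝ × ℝ^d)}`, valued in `[0, ∞]`. -/
def spacetimeNorm (d : ℕ) (r : ℝ≥0∞) (u : ℝ → Euc d → ℝ) : ℝ≥0∞ :=
  eLpNorm (Function.uncurry u) r volume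

/-- The functions `vt, vr, vtt, vtr, vrr` are the continuous partial derivatives of orders one and
two of a function `v` of two real variables `t, r`. -/
structure HasSecondPartials (v vt vr vtt vtr vrr : ℝ → ℝ → ℝ) : Prop where
  cont : Continuous (Function.uncurry v)
  cont_t : Continuous (Function.uncurry vt)
  cont_r : Continuous (Function.uncurry vr)
  cont_tt : Continuous (Function.uncurry vtt)
  cont_tr : Continuous (Function.uncurry vtr)
  cont_rr : Continuous (Function.uncurry vrr)
  deriv_t : ∀ t r, HasDerivAt (fun s => v s r) (vt t r) t
  deriv_r : ∀ t r, HasDerivAt (v t) (vr t r) r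
  deriv_tt : ∀ t r, HasDerivAt (fun s => vt s r) (vtt t r) t
  deriv_tr : ∀ t r, HasDerivAt (vt t) (vtr t r) r
  deriv_rt : ∀ t r, HasDerivAt (fun s => vr s r) (vtr t r) t
  deriv_rr : ∀ t r, HasDerivAt (vr t) (vrr t r) r

/-- The partial derivative in the first variable. -/
def partialFst (f : ℝ → ℝ → ℝ) (t r : ℝ) : ℝ := deriv (fun s => f s r) t

/-- The partial derivative in the second variable. -/
def partialSnd (f : ℝ → ℝ → ℝ) (t r : ℝ) : ℝ := deriv (f t) r

lemma hasDerivAt_fst_fderiv {f : ℝ → ℝ → ℝ} (hf : ContDiff ℝ (⊤ : ℕ∞) (Function.uncurry f))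
    (t r : ℝ) : HasDerivAt (fun s => f s r) (fderiv ℝ (Function.uncurry f) (t, r) (1, 0)) t := by
  have h := (hf.differentiable (by simp) (t, r)).hasFDerivAt
  have h2 : HasDerivAt (fun s : ℝ => (s, r)) ((1 : ℝ), (0 : ℝ)) t :=
    (hasDerivAt_id t).prodMk (hasDerivAt_const t r)
  exact h.comp_hasDerivAt t h2

lemma hasDerivAt_snd_fderiv {f : ℝ → ℝ → ℝ} (hf : ContDiff ℝ (⊤ : ℕ∞) (Function.uncurry f))
    (t r : ℝ) : HasDerivAt (f t) (fderiv ℝ (Function.uncurry f) (t, r) (0, 1)) r := by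
  have h := (hf.differentiable (by simp) (t, r)).hasFDerivAt
  have h2 : HasDerivAt (fun s : ℝ => (t, s)) ((0 : ℝ), (1 : ℝ)) r :=
    (hasDerivAt_const r t).prodMk (hasDerivAt_id r)
  exact h.comp_hasDerivAt r h2

lemma uncurry_partialFst {f : ℝ → ℝ → ℝ} (hf : ContDiff ℝ (⊤ : ℕ∞) (Function.uncurry f)) :
    Function.uncurry (partialFst f) = fun p => fderiv ℝ (Function.uncurry f) p (1, 0) :=
  funext fun p => (hasDerivAt_fst_fderiv hf p.1 p.2).deriv

lemma uncurry_partialSnd {f : ℝ → ℝ → ℝ} (hf : ContDiff ℝ (⊤ : ℕ∞) (Function.uncurry f)) :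
    Function.uncurry (partialSnd f) = fun p => fderiv ℝ (Function.uncurry f) p (0, 1) :=
  funext fun p => (hasDerivAt_snd_fderiv hf p.1 p.2).deriv

lemma contDiff_partialFst {f : ℝ → ℝ → ℝ} (hf : ContDiff ℝ (⊤ : ℕ∞) (Function.uncurry f)) :
    ContDiff ℝ (⊤ : ℕ∞) (Function.uncurry (partialFst f)) := by
  rw [uncurry_partialFst hf]
  exact (hf.fderiv_right (by simp)).clm_apply contDiff_const

lemma contDiff_partialSnd {f : ℝ → ℝ → ℝ} (hf : ContDiff ℝ (⊤ : ℕ∞) (Function.uncurry f)) :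
    ContDiff ℝ (⊤ : ℕ∞) (Function.uncurry (partialSnd f)) := by
  rw [uncurry_partialSnd hf]
  exact (hf.fderiv_right (by simp)).clm_apply contDiff_const

lemma hasDerivAt_partialFst {f : ℝ → ℝ → ℝ} (hf : ContDiff ℝ (⊤ : ℕ∞) (Function.uncurry f))
    (t r : ℝ) : HasDerivAt (fun s => f s r) (partialFst f t r) t :=
  (hasDerivAt_fst_fderiv hf t r).differentiableAt.hasDerivAt

lemma hasDerivAt_partialSnd {f : ℝ → ℝ → ℝ} (hf : ContDiff ℝ (⊤ : ℕ∞) (Function.uncurry f))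
    (t r : ℝ) : HasDerivAt (f t) (partialSnd f t r) r :=
  (hasDerivAt_snd_fderiv hf t r).differentiableAt.hasDerivAt

lemma partialFst_partialSnd {f : ℝ → ℝ → ℝ} (hf : ContDiff ℝ (⊤ : ℕ∞) (Function.uncurry f))
    (t r : ℝ) : partialFst (partialSnd f) t r = partialSnd (partialFst f) t r := by
  have hd : DifferentiableAt ℝ (fderiv ℝ (Function.uncurry f)) (t, r) :=
    (hf.fderiv_right (m := (⊤ : ℕ∞)) (by simp)).differentiable (by simp) (t, r)
  have hsymm : IsSymmSndFDerivAt ℝ (Function.uncurry f) (t, r) :=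
    hf.contDiffAt.isSymmSndFDerivAt (by
      rw [minSmoothness_of_isRCLikeNormedField]
      exact WithTop.coe_le_coe.2 (le_top : (2 : ℕ∞) ≤ ⊤))
  have h1 := (hasDerivAt_fst_fderiv (contDiff_partialSnd hf) t r).deriv
  have h2 := (hasDerivAt_snd_fderiv (contDiff_partialFst hf) t r).deriv
  rw [partialFst, partialSnd, h1, h2, uncurry_partialFst hf, uncurry_partialSnd hf,
    fderiv_clm_apply hd (by fun_prop), fderiv_clm_apply hd (by fun_prop)]
  simpa using hsymm.eq (1, 0) (0, 1)

lemma hasSecondPartials_of_contDiff {f : ℝ → ℝ → ℝ}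
    (hf : ContDiff ℝ (⊤ : ℕ∞) (Function.uncurry f)) :
    HasSecondPartials f (partialFst f) (partialSnd f) (partialFst (partialFst f))
      (partialSnd (partialFst f)) (partialSnd (partialSnd f)) where
  cont := hf.continuous
  cont_t := (contDiff_partialFst hf).continuous
  cont_r := (contDiff_partialSnd hf).continuous
  cont_tt := (contDiff_partialFst (contDiff_partialFst hf)).continuous
  cont_tr := (contDiff_partialSnd (contDiff_partialFst hf)).continuous
  cont_rr := (contDiff_partialSnd (contDiff_partialSnd hf)).continuous
  deriv_t := hasDerivAt_partialFst hf
  deriv_r := hasDerivAt_partialSnd hf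
  deriv_tt := hasDerivAt_partialFst (contDiff_partialFst hf)
  deriv_tr := hasDerivAt_partialSnd (contDiff_partialFst hf)
  deriv_rt t r := by
    rw [← partialFst_partialSnd hf]
    exact hasDerivAt_partialFst (contDiff_partialSnd hf) t r
  deriv_rr := hasDerivAt_partialSnd (contDiff_partialSnd hf)

/-- Integration over the rectangle `[0, T] × [a, b]` of a balance law `∂ₜ A = ∂ᵣ B + S`. -/
lemma integral_balance_law {A At B Br S : ℝ → ℝ → ℝ} {T a b : ℝ} (hT : 0 ≤ T) (hab : a ≤ b)
    (hA : ∀ t r, HasDerivAt (fun s => A s r) (At t r) t)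
    (hB : ∀ t r, HasDerivAt (B t) (Br t r) r)
    (cA : Continuous (Function.uncurry A)) (cAt : Continuous (Function.uncurry At))
    (cB : Continuous (Function.uncurry B)) (cBr : Continuous (Function.uncurry Br))
    (cS : Continuous (Function.uncurry S))
    (h : ∀ t ∈ Icc 0 T, ∀ r ∈ Ioc a b, At t r = Br t r + S t r) :
    (∫ r in a..b, A T r) - ∫ r in a..b, A 0 r =
      (∫ t in (0 : ℝ)..T, (B t b - B t a)) + ∫ t in (0 : ℝ)..T, ∫ r in a..b, S t r := by
  have slice_r : ∀ {F : ℝ → ℝ → ℝ}, Continuous (Function.uncurry F) → ∀ t, Continuous (F t) :=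
    fun hF t => hF.comp (by fun_prop : Continuous fun r : ℝ => (t, r))
  have slice_t : ∀ {F : ℝ → ℝ → ℝ}, Continuous (Function.uncurry F) → ∀ r,
      Continuous (fun t => F t r) :=
    fun hF r => hF.comp (by fun_prop : Continuous fun t : ℝ => (t, r))
  have e1 : (∫ r in a..b, A T r) - ∫ r in a..b, A 0 r =
      ∫ r in a..b, ∫ t in (0 : ℝ)..T, At t r := by
    rw [← intervalIntegral.integral_sub ((slice_r cA T).intervalIntegrable _ _)
      ((slice_r cA 0).intervalIntegrable _ _)]
    refine intervalIntegral.integral_congr fun r _ => ?_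
    exact (intervalIntegral.integral_eq_sub_of_hasDerivAt (fun t _ => hA t r)
      ((slice_t cAt r).intervalIntegrable _ _)).symm
  have swap : ∫ r in a..b, ∫ t in (0 : ℝ)..T, At t r = ∫ t in (0 : ℝ)..T, ∫ r in a..b, At t r := by
    refine MeasureTheory.intervalIntegral_intervalIntegral_swap ?_
    have : Continuous (Function.uncurry fun r t => At t r) := cAt.comp continuous_swap
    exact (this.continuousOn.integrableOn_compact
      (isCompact_uIcc.prod isCompact_uIcc)).mono_set
      (prod_mono uIoc_subset_uIcc uIoc_subset_uIcc)
  have cont_int : ∀ {F : ℝ → ℝ → ℝ}, Continuous (Function.uncurry F) →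
      Continuous fun t => ∫ r in a..b, F t r :=
    fun hF => intervalIntegral.continuous_parametric_intervalIntegral_of_continuous' hF a b
  rw [e1, swap, ← intervalIntegral.integral_add
    (Continuous.intervalIntegrable (u := fun t => B t b - B t a)
      ((slice_t cB b).sub (slice_t cB a)) _ _)
    ((cont_int cS).intervalIntegrable _ _)]
  refine intervalIntegral.integral_congr fun t ht => ?_
  rw [uIcc_of_le hT] at ht
  have e2 : ∫ r in a..b, At t r = ∫ r in a..b, (Br t r + S t r) := by
    refine intervalIntegral.integral_congr_ae (Filter.Eventually.of_forall fun r hr => ?_)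
    rw [uIoc_of_le hab] at hr
    exact h t ht r hr
  have e3 : ∫ r in a..b, Br t r = B t b - B t a :=
    intervalIntegral.integral_eq_sub_of_hasDerivAt (fun r _ => hB t r)
      ((slice_r cBr t).intervalIntegrable _ _)
  rw [e2, intervalIntegral.integral_add ((slice_r cBr t).intervalIntegrable _ _)
    ((slice_r cS t).intervalIntegrable _ _), e3]

/-- The potential energy density `|x|^(α+2)/(α+2)`, a primitive of `|x|^α x`. -/
def potential (α x : ℝ) : ℝ := |x| ^ (α + 2) / (α + 2)

lemma hasDerivAt_potential {α : ℝ} (hα : 0 < α) (x : ℝ) :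
    HasDerivAt (potential α) (|x| ^ α * x) x := by
  have h := (hasDerivAt_abs_rpow x (p := α + 2) (by linarith)).div_const (α + 2)
  have e : (α + 2) * |x| ^ (α + 2 - 2) * x / (α + 2) = |x| ^ α * x := by
    rw [show α + 2 - 2 = α by ring]
    field_simp
  rwa [e] at h

lemma potential_nonneg {α : ℝ} (hα : 0 < α) (x : ℝ) : 0 ≤ potential α x := by
  unfold potential
  positivity

lemma continuous_potential {α : ℝ} (hα : 0 < α) : Continuous (potential α) :=
  continuous_iff_continuousAt.2 fun x => (hasDerivAt_potential hα x).continuousAt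

lemma potential_zero {α : ℝ} (hα : 0 < α) : potential α 0 = 0 := by
  simp [potential, Real.zero_rpow (by linarith : α + 2 ≠ 0)]

lemma rpow_mul_sq_eq_potential {α : ℝ} (hα : 0 < α) (x : ℝ) :
    |x| ^ α * x * x = (α + 2) * potential α x := by
  unfold potential
  rw [mul_assoc, ← sq, ← sq_abs x, ← Real.rpow_natCast |x| 2, ← Real.rpow_add_of_nonneg
    (abs_nonneg x) hα.le (by norm_num)]
  field_simp
  norm_num

namespace HasSecondPartials

variable {v vt vr vtt vtr vrr : ℝ → ℝ → ℝ}

/-- Finite speed of propagation for the radial equation. -/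
lemma eq_zero_of_initial_eq_zero (H : HasSecondPartials v vt vr vtt vtr vrr) {T R α : ℝ} {j : ℕ}
    (hα : 0 < α) (hR : 0 ≤ R)
    (hpde : ∀ t ∈ Icc 0 T, ∀ r, 0 < r →
      vtt t r - vrr t r - (j + 1) / r * vr t r + |v t r| ^ α * v t r = 0)
    (hv0 : ∀ r, R < r → v 0 r = 0) (hvt0 : ∀ r, R < r → vt 0 r = 0)
    {t r : ℝ} (ht : t ∈ Icc 0 T) (hr : R + t < r) : v t r = 0 := by
  have hvr0 : ∀ r, R < r → vr 0 r = 0 := fun r hr => by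
    have h1 : v 0 =ᶠ[nhds r] fun _ => 0 := by
      filter_upwards [lt_mem_nhds hr] with s hs using hv0 s hs
    exact (H.deriv_r 0 r).unique ((hasDerivAt_const r 0).congr_of_eventuallyEq h1)
  set ψ : ℝ → ℝ := expNegInvGlue
  have ψdiff : ∀ x, HasDerivAt ψ (deriv ψ x) x := fun x =>
    ((expNegInvGlue.contDiff (n := 1)).differentiable (by simp) x).hasDerivAt
  have cψ : Continuous ψ := (expNegInvGlue.contDiff (n := 0)).continuous
  have cψ' : Continuous (deriv ψ) := (expNegInvGlue.contDiff (n := 1)).continuous_deriv (by simp)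
  have ψ'_nonneg : ∀ x, 0 ≤ deriv ψ x := fun x => expNegInvGlue.monotone.deriv_nonneg
  have ψ_nonneg : ∀ x, 0 ≤ ψ x := expNegInvGlue.nonneg
  set L : ℝ := r + t + 1
  have cV := H.cont
  have cVt := H.cont_t
  have cVr := H.cont_r
  have cVtt := H.cont_tt
  have cVtr := H.cont_tr
  have cVrr := H.cont_rr
  have cP := continuous_potential hα
  have cN : Continuous fun x : ℝ => |x| ^ α * x :=
    (continuous_abs.rpow_const fun _ => Or.inr hα.le).mul continuous_id
  let e : ℝ → ℝ → ℝ := fun t r =>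
    r ^ (j + 1) * (vt t r ^ 2 / 2 + vr t r ^ 2 / 2 + potential α (v t r))
  let et : ℝ → ℝ → ℝ := fun t r =>
    r ^ (j + 1) * (vt t r * vtt t r + vr t r * vtr t r + |v t r| ^ α * v t r * vt t r)
  let b : ℝ → ℝ → ℝ := fun t r => r ^ (j + 1) * (vt t r * vr t r)
  let br : ℝ → ℝ → ℝ := fun t r =>
    (j + 1) * r ^ j * (vt t r * vr t r) + r ^ (j + 1) * (vtr t r * vr t r + vt t r * vrr t r)
  let φ : ℝ → ℝ → ℝ := fun t r => ψ (r - R - t) * ψ (L - t - r)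
  let φt : ℝ → ℝ → ℝ := fun t r =>
    -(deriv ψ (r - R - t) * ψ (L - t - r)) - ψ (r - R - t) * deriv ψ (L - t - r)
  let φr : ℝ → ℝ → ℝ := fun t r =>
    deriv ψ (r - R - t) * ψ (L - t - r) - ψ (r - R - t) * deriv ψ (L - t - r)
  have he : ∀ t r, HasDerivAt (fun s => e s r) (et t r) t := fun t r => by
    have h := ((((H.deriv_tt t r).pow 2).div_const 2).add (((H.deriv_rt t r).pow 2).div_const 2)
      |>.add ((hasDerivAt_potential hα (v t r)).comp t (H.deriv_t t r))).const_mul (r ^ (j + 1))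
    refine h.congr_deriv ?_
    simp only [et]
    push_cast
    ring
  have hb : ∀ t r, HasDerivAt (b t) (br t r) r := fun t r => by
    have h := (hasDerivAt_pow (j + 1) r).mul ((H.deriv_tr t r).mul (H.deriv_rr t r))
    refine h.congr_deriv ?_
    simp only [br, add_tsub_cancel_right, Pi.mul_apply]
    push_cast
    ring
  have hφt : ∀ t r, HasDerivAt (fun s => φ s r) (φt t r) t := fun t r => by
    have h1 := (ψdiff (r - R - t)).comp t ((hasDerivAt_id t).const_sub (r - R))
    have h2 := (ψdiff (L - t - r)).comp t (((hasDerivAt_id t).const_sub L).sub_const r)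
    refine (h1.mul h2).congr_deriv ?_
    simp only [φt, Function.comp, id]
    ring
  have hφr : ∀ t r, HasDerivAt (φ t) (φr t r) r := fun t r => by
    have h1 := (ψdiff (r - R - t)).comp r (((hasDerivAt_id r).sub_const R).sub_const t)
    have h2 := (ψdiff (L - t - r)).comp r ((hasDerivAt_id r).const_sub (L - t))
    refine (h1.mul h2).congr_deriv ?_
    simp only [φr, Function.comp, id]
    ring
  have ce : Continuous (Function.uncurry e) := by
    have : Continuous fun p : ℝ × ℝ => potential α (v p.1 p.2) := cP.comp cV
    simp only [Function.uncurry_def, e] at *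
    fun_prop
  have cet : Continuous (Function.uncurry et) := by
    have : Continuous fun p : ℝ × ℝ => |v p.1 p.2| ^ α * v p.1 p.2 := cN.comp cV
    simp only [Function.uncurry_def, et] at *
    fun_prop
  have cb : Continuous (Function.uncurry b) := by
    simp only [Function.uncurry_def, b] at *
    fun_prop
  have cbr : Continuous (Function.uncurry br) := by
    simp only [Function.uncurry_def, br] at *
    fun_prop
  have cφ : Continuous (Function.uncurry φ) := by
    simp only [Function.uncurry_def, φ]
    fun_prop
  have cφt : Continuous (Function.uncurry φt) := by
    simp only [Function.uncurry_def, φt]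
    fun_prop
  have cφr : Continuous (Function.uncurry φr) := by
    simp only [Function.uncurry_def, φr]
    fun_prop
  have energy : ∀ s ∈ Icc 0 t, ∀ x ∈ Ioc R L, et s x = br s x := fun s hs x hx => by
    have hx0 : 0 < x := hR.trans_lt hx.1
    have h := hpde s ⟨hs.1, hs.2.trans ht.2⟩ x hx0
    have h' : vtt s x = vrr s x + (j + 1) / x * vr s x - |v s x| ^ α * v s x := by linarith
    simp only [et, br, h']
    field_simp
    ring
  have hrL : r < L := by linarith [ht.1]
  have balance := integral_balance_law (A := fun t r => φ t r * e t r)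
    (At := fun t r => φt t r * e t r + φ t r * et t r)
    (B := fun t r => φ t r * b t r) (Br := fun t r => φr t r * b t r + φ t r * br t r)
    (S := fun t r => φt t r * e t r - φr t r * b t r) (T := t) (a := R) (b := L) ht.1
    (by linarith [ht.1]) (fun t r => (hφt t r).mul (he t r)) (fun t r => (hφr t r).mul (hb t r))
    (cφ.mul ce) ((cφt.mul ce).add (cφ.mul cet)) (cφ.mul cb) ((cφr.mul cb).add (cφ.mul cbr))
    ((cφt.mul ce).sub (cφr.mul cb))
    (fun s hs x hx => by simp only [energy s hs x hx]; ring)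
  have initial : ∫ x in R..L, φ 0 x * e 0 x = 0 := by
    refine (intervalIntegral.integral_congr_ae (g := fun _ => (0 : ℝ))
      (Filter.Eventually.of_forall fun x hx => ?_)).trans intervalIntegral.integral_zero
    rw [uIoc_of_le (by linarith [ht.1])] at hx
    simp [e, hv0 x hx.1, hvt0 x hx.1, hvr0 x hx.1, potential_zero hα]
  have bdry : ∫ s in (0 : ℝ)..t, (φ s L * b s L - φ s R * b s R) = 0 := by
    refine (intervalIntegral.integral_congr (g := fun _ => (0 : ℝ)) fun s hs => ?_).trans
      intervalIntegral.integral_zero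
    rw [uIcc_of_le ht.1] at hs
    have h1 : ψ (L - s - L) = 0 := expNegInvGlue.zero_of_nonpos (by linarith [hs.1])
    have h2 : ψ (R - R - s) = 0 := expNegInvGlue.zero_of_nonpos (by linarith [hs.1])
    simp only [φ, h1, h2]
    ring
  have source : ∫ s in (0 : ℝ)..t, ∫ x in R..L, (φt s x * e s x - φr s x * b s x) ≤ 0 := by
    rw [← neg_nonneg, ← intervalIntegral.integral_neg]
    refine intervalIntegral.integral_nonneg ht.1 fun s _ => ?_
    rw [← intervalIntegral.integral_neg]
    refine intervalIntegral.integral_nonneg (by linarith [ht.1]) fun x hx => ?_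
    have hx0 : 0 ≤ x := hR.trans hx.1
    have hpos : 0 ≤ x ^ (j + 1) := by positivity
    have hP := potential_nonneg hα (v s x)
    have h1 : 0 ≤ deriv ψ (x - R - s) * ψ (L - s - x) := mul_nonneg (ψ'_nonneg _) (ψ_nonneg _)
    have h2 : 0 ≤ ψ (x - R - s) * deriv ψ (L - s - x) := mul_nonneg (ψ_nonneg _) (ψ'_nonneg _)
    have h3 : 0 ≤ e s x + b s x := by
      have : e s x + b s x = x ^ (j + 1) * ((vt s x + vr s x) ^ 2 / 2 + potential α (v s x)) := by
        simp only [e, b]; ring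
      rw [this]; positivity
    have h4 : 0 ≤ e s x - b s x := by
      have : e s x - b s x = x ^ (j + 1) * ((vt s x - vr s x) ^ 2 / 2 + potential α (v s x)) := by
        simp only [e, b]; ring
      rw [this]; positivity
    simp only [φt, φr]
    nlinarith [mul_nonneg h1 h3, mul_nonneg h2 h4]
  simp only [initial, bdry] at balance
  by_contra hne
  have hpos : 0 < ∫ x in R..L, φ t x * e t x := by
    refine intervalIntegral.integral_pos (by linarith [ht.1]) ?_ (fun x hx => ?_)
      ⟨r, ⟨by linarith [ht.1], hrL.le⟩, ?_⟩
    · exact ((cφ.mul ce).comp (by fun_prop : Continuous fun x : ℝ => (t, x))).continuousOn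
    · have hx0 : 0 ≤ x := hR.trans hx.1.le
      have hP := potential_nonneg hα (v t x)
      have := ψ_nonneg (x - R - t)
      have := ψ_nonneg (L - t - x)
      simp only [φ, e]
      positivity
    · have hr0 : 0 < r := by linarith [ht.1]
      have h1 : 0 < ψ (r - R - t) := expNegInvGlue.pos_of_pos (by linarith)
      have h2 : 0 < ψ (L - t - r) := expNegInvGlue.pos_of_pos (by linarith)
      have h3 : 0 < potential α (v t r) := by
        have := abs_pos.2 hne
        unfold potential
        positivity
      simp only [φ, e]
      positivity
  linarith

end HasSecondPartials

lemma deriv_eq_of_eqOn_Icc {f g : ℝ → ℝ} {f' g' t T : ℝ} (hT : 0 < T) (ht : t ∈ Icc 0 T)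
    (h : EqOn f g (Icc 0 T)) (hf : HasDerivAt f f' t) (hg : HasDerivAt g g' t) : f' = g' :=
  (uniqueDiffOn_Icc hT t ht).eq_deriv _ (hf.hasDerivWithinAt (s := Icc 0 T))
    (hg.hasDerivWithinAt.congr (fun _ hx => h hx) (h ht))

/-- Control of the Morawetz momentum of a time slice by its kinetic energy. -/
lemma abs_integral_momentum_le {f g h : ℝ → ℝ} {R : ℝ} (m : ℕ) (hR : 0 ≤ R) (hfR : f R = 0)
    (hfg : ∀ r, HasDerivAt f (g r) r) (cg : Continuous g) (ch : Continuous h) :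
    |∫ r in (0 : ℝ)..R, (r ^ (m + 3) * (h r * g r) + (m + 3) / 2 * r ^ (m + 2) * (f r * h r))| ≤
      (∫ r in (0 : ℝ)..R, r ^ (m + 3) * (g r ^ 2 + h r ^ 2)) / 2 := by
  have cf : Continuous f := continuous_iff_continuousAt.2 fun r => (hfg r).continuousAt
  let w : ℝ → ℝ := fun r => ((m : ℝ) + 3) / 4 *
    ((m + 2) * r ^ (m + 1) * f r ^ 2 + r ^ (m + 2) * (2 * f r * g r))
  have hw : ∫ r in (0 : ℝ)..R, w r = 0 := by
    have hd : ∀ r, HasDerivAt (fun r => ((m : ℝ) + 3) / 4 * (r ^ (m + 2) * f r ^ 2)) (w r) r := by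
      intro r
      have := ((hasDerivAt_pow (m + 2) r).mul ((hfg r).pow 2)).const_mul (((m : ℝ) + 3) / 4)
      refine this.congr_deriv ?_
      simp only [w, Pi.pow_apply]
      push_cast
      simp
    rw [intervalIntegral.integral_eq_sub_of_hasDerivAt (fun r _ => hd r)
      (Continuous.intervalIntegrable (by fun_prop) _ _)]
    simp [hfR]
  have key : ∀ σ : ℝ, σ ^ 2 = 1 → σ * (∫ r in (0 : ℝ)..R,
      (r ^ (m + 3) * (h r * g r) + (m + 3) / 2 * r ^ (m + 2) * (f r * h r))) ≤
      (∫ r in (0 : ℝ)..R, r ^ (m + 3) * (g r ^ 2 + h r ^ 2)) / 2 := by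
    intro σ hσ
    have split : (∫ r in (0 : ℝ)..R, r ^ (m + 3) * (g r ^ 2 + h r ^ 2)) / 2 =
        ∫ r in (0 : ℝ)..R, (r ^ (m + 3) * (g r ^ 2 + h r ^ 2) / 2 + w r) := by
      rw [intervalIntegral.integral_add (Continuous.intervalIntegrable (by fun_prop) _ _)
        (Continuous.intervalIntegrable (by fun_prop) _ _), hw, add_zero,
        intervalIntegral.integral_div]
    rw [← intervalIntegral.integral_const_mul, split]
    refine intervalIntegral.integral_mono_on hR (Continuous.intervalIntegrable (by fun_prop) _ _)
      (Continuous.intervalIntegrable (by fun_prop) _ _) fun r hr => ?_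
    have hr0 : 0 ≤ r := hr.1
    have e : r ^ (m + 3) * (g r ^ 2 + h r ^ 2) / 2 + w r - σ * (r ^ (m + 3) * (h r * g r) +
        (m + 3) / 2 * r ^ (m + 2) * (f r * h r)) =
        r ^ (m + 1) * (r * h r - σ * (r * g r + (m + 3) / 2 * f r)) ^ 2 / 2 +
          (m + 3) * (m + 1) / 8 * r ^ (m + 1) * f r ^ 2 +
          (1 - σ ^ 2) * r ^ (m + 1) * (r * g r + (m + 3) / 2 * f r) ^ 2 / 2 := by
      simp only [w]
      ring
    have : 0 ≤ r ^ (m + 1) * (r * h r - σ * (r * g r + (m + 3) / 2 * f r)) ^ 2 / 2 +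
          (m + 3) * (m + 1) / 8 * r ^ (m + 1) * f r ^ 2 := by positivity
    rw [hσ] at e
    linarith
  rw [abs_le]
  constructor <;> [have := key (-1) (by norm_num); have := key 1 (by norm_num)] <;> linarith

namespace HasSecondPartials

variable {v vt vr vtt vtr vrr : ℝ → ℝ → ℝ}

/-- The Morawetz estimate for the radial equation. -/
lemma integral_morawetz_le (H : HasSecondPartials v vt vr vtt vtr vrr) {T R ρ : ℝ} {m : ℕ}
    (hT : 0 < T) (hR : 0 ≤ R) (hρ : ρ < R)
    (hpde : ∀ t ∈ Icc 0 T, ∀ r, 0 < r →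
      vtt t r - vrr t r - (m + 3) / r * vr t r + |v t r| ^ (4 / (m + 3) : ℝ) * v t r = 0)
    (hsupp : ∀ t ∈ Icc 0 T, ∀ r, ρ < r → v t r = 0) :
    ∫ t in (0 : ℝ)..T, ∫ r in (0 : ℝ)..R,
        (r ^ m * v t r ^ 2 + r ^ (m + 2) * |v t r| ^ (4 / (m + 3) + 2 : ℝ)) ≤
      (∫ r in (0 : ℝ)..R, r ^ (m + 3) * (vr 0 r ^ 2 + vt 0 r ^ 2)) +
        ∫ r in (0 : ℝ)..R, r ^ (m + 3) * (vr T r ^ 2 + vt T r ^ 2) := by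
  set α : ℝ := 4 / (m + 3) with hα_def
  have hm : (0 : ℝ) ≤ m := m.cast_nonneg
  have hα : 0 < α := by positivity
  have hαm : (m + 3) * α = 4 := by rw [hα_def]; field_simp
  have hα2 : α ≤ 4 / 3 := by
    rw [hα_def]
    gcongr
    linarith
  have cV := H.cont
  have cVt := H.cont_t
  have cVr := H.cont_r
  have cVtt := H.cont_tt
  have cVtr := H.cont_tr
  have cVrr := H.cont_rr
  have cN : Continuous fun p : ℝ × ℝ => |v p.1 p.2| ^ α * v p.1 p.2 :=
    ((continuous_abs.rpow_const fun _ => Or.inr hα.le).mul continuous_id).comp cV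
  have cP : Continuous fun p : ℝ × ℝ => potential α (v p.1 p.2) :=
    (continuous_potential hα).comp cV
  let A : ℝ → ℝ → ℝ := fun t r =>
    r ^ (m + 3) * (vt t r * vr t r) + (m + 3) / 2 * r ^ (m + 2) * (v t r * vt t r)
  let At : ℝ → ℝ → ℝ := fun t r =>
    r ^ (m + 3) * (vtt t r * vr t r + vt t r * vtr t r) +
      (m + 3) / 2 * r ^ (m + 2) * (vt t r * vt t r + v t r * vtt t r)
  let B : ℝ → ℝ → ℝ := fun t r =>
    r ^ (m + 3) * (vt t r ^ 2 / 2 + vr t r ^ 2 / 2 - potential α (v t r)) +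
      (m + 3) / 2 * (r ^ (m + 2) * (v t r * vr t r)) +
      (m + 3) / 4 * (r ^ (m + 1) * v t r ^ 2)
  let Br : ℝ → ℝ → ℝ := fun t r =>
    ((m + 3) * r ^ (m + 2) * (vt t r ^ 2 / 2 + vr t r ^ 2 / 2 - potential α (v t r)) +
      r ^ (m + 3) * (vt t r * vtr t r + vr t r * vrr t r - |v t r| ^ α * v t r * vr t r)) +
      (m + 3) / 2 * ((m + 2) * r ^ (m + 1) * (v t r * vr t r) +
        r ^ (m + 2) * (vr t r * vr t r + v t r * vrr t r)) +
      (m + 3) / 4 * ((m + 1) * r ^ m * v t r ^ 2 + r ^ (m + 1) * (2 * v t r * vr t r))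
  let S : ℝ → ℝ → ℝ := fun t r =>
    -((m + 3) * (m + 1) / 4 * (r ^ m * v t r ^ 2) + 2 * (r ^ (m + 2) * potential α (v t r)))
  have hA : ∀ t r, HasDerivAt (fun s => A s r) (At t r) t := fun t r =>
    (((H.deriv_tt t r).mul (H.deriv_rt t r)).const_mul _).add
      (((H.deriv_t t r).mul (H.deriv_tt t r)).const_mul _)
  have hB : ∀ t r, HasDerivAt (B t) (Br t r) r := fun t r => by
    have h1 := (hasDerivAt_pow (m + 3) r).mul (((((H.deriv_tr t r).pow 2).div_const 2).add
      (((H.deriv_rr t r).pow 2).div_const 2)).sub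
      ((hasDerivAt_potential hα (v t r)).comp r (H.deriv_r t r)))
    have h2 := ((hasDerivAt_pow (m + 2) r).mul
      ((H.deriv_r t r).mul (H.deriv_rr t r))).const_mul (((m : ℝ) + 3) / 2)
    have h3 := ((hasDerivAt_pow (m + 1) r).mul
      ((H.deriv_r t r).pow 2)).const_mul (((m : ℝ) + 3) / 4)
    refine ((h1.add h2).add h3).congr_deriv ?_
    simp only [Br, Pi.add_apply, Pi.sub_apply, Pi.mul_apply, Pi.pow_apply, Function.comp,
      show m + 3 - 1 = m + 2 from rfl, show m + 2 - 1 = m + 1 from rfl, add_tsub_cancel_right]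
    push_cast
    ring
  have cA : Continuous (Function.uncurry A) := by
    simp only [Function.uncurry_def, A] at *
    fun_prop
  have cAt : Continuous (Function.uncurry At) := by
    simp only [Function.uncurry_def, At] at *
    fun_prop
  have cB : Continuous (Function.uncurry B) := by
    simp only [Function.uncurry_def, B] at *
    fun_prop
  have cBr : Continuous (Function.uncurry Br) := by
    simp only [Function.uncurry_def, Br] at *
    fun_prop
  have cS : Continuous (Function.uncurry S) := by
    simp only [Function.uncurry_def, S] at *
    fun_prop
  have law : ∀ t ∈ Icc 0 T, ∀ r ∈ Ioc 0 R, At t r = Br t r + S t r := fun t ht r hr => by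
    have hr0 : 0 < r := hr.1
    have h := hpde t ht r hr0
    have h' : r * vtt t r =
        r * vrr t r + (m + 3) * vr t r - r * (|v t r| ^ α * v t r) := by
      field_simp at h
      linarith
    have hp := rpow_mul_sq_eq_potential hα (v t r)
    simp only [At, Br, S]
    generalize |v t r| ^ α * v t r = N at h' hp ⊢
    linear_combination (r ^ (m + 2) * vr t r + (m + 3) / 2 * r ^ (m + 1) * v t r) * h'
      - (m + 3) / 2 * r ^ (m + 2) * hp - r ^ (m + 2) * potential α (v t r) / 2 * hαm
  have bdry : ∫ t in (0 : ℝ)..T, (B t R - B t 0) = 0 := by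
    refine (intervalIntegral.integral_congr (g := fun _ => (0 : ℝ)) fun t ht => ?_).trans
      intervalIntegral.integral_zero
    rw [uIcc_of_le hT.le] at ht
    have h1 : vt t R = 0 := deriv_eq_of_eqOn_Icc hT ht (g := fun _ => 0)
      (fun s hs => hsupp s hs R hρ) (H.deriv_t t R) (hasDerivAt_const t 0)
    have h2 : vr t R = 0 := by
      have h1 : v t =ᶠ[nhds R] fun _ => 0 := by
        filter_upwards [lt_mem_nhds hρ] with s hs using hsupp t ht s hs
      exact (H.deriv_r t R).unique ((hasDerivAt_const R 0).congr_of_eventuallyEq h1)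
    simp [B, h1, h2, hsupp t ht R hρ, potential_zero hα]
  have balance := integral_balance_law hT.le hR hA hB cA cAt cB cBr cS law
  rw [bdry, zero_add] at balance
  have slice : ∀ {F : ℝ → ℝ → ℝ}, Continuous (Function.uncurry F) → ∀ t, Continuous (F t) :=
    fun hF t => hF.comp (by fun_prop : Continuous fun r : ℝ => (t, r))
  have bound : ∀ t ∈ Icc 0 T, |∫ r in (0 : ℝ)..R, A t r| ≤
      (∫ r in (0 : ℝ)..R, r ^ (m + 3) * (vr t r ^ 2 + vt t r ^ 2)) / 2 := fun t ht =>
    abs_integral_momentum_le m hR (hsupp t ht R hρ) (H.deriv_r t) (slice cVr t) (slice cVt t)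
  have b0 := (abs_le.1 (bound 0 ⟨le_rfl, hT.le⟩)).2
  have bT := (abs_le.1 (bound T ⟨hT.le, le_rfl⟩)).1
  let G : ℝ → ℝ → ℝ := fun t r => r ^ m * v t r ^ 2 + r ^ (m + 2) * |v t r| ^ (α + 2)
  have cG : Continuous (Function.uncurry G) := by
    have : Continuous fun p : ℝ × ℝ => |v p.1 p.2| ^ (α + 2) :=
      (continuous_abs.rpow_const fun _ => Or.inr (by linarith)).comp cV
    simp only [Function.uncurry_def, G] at *
    fun_prop
  have cont_int : ∀ {F : ℝ → ℝ → ℝ}, Continuous (Function.uncurry F) →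
      Continuous fun t => ∫ r in (0 : ℝ)..R, F t r :=
    fun hF => intervalIntegral.continuous_parametric_intervalIntegral_of_continuous' hF 0 R
  have compare : ∫ t in (0 : ℝ)..T, ∫ r in (0 : ℝ)..R, G t r ≤
      -2 * ∫ t in (0 : ℝ)..T, ∫ r in (0 : ℝ)..R, S t r := by
    rw [← intervalIntegral.integral_const_mul]
    refine intervalIntegral.integral_mono_on hT.le ((cont_int cG).intervalIntegrable _ _)
      (((cont_int cS).const_mul _).intervalIntegrable _ _) fun t _ => ?_
    rw [← intervalIntegral.integral_const_mul]
    refine intervalIntegral.integral_mono_on hR ((slice cG t).intervalIntegrable _ _)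
      (((slice cS t).const_mul _).intervalIntegrable _ _) fun r hr => ?_
    have hr0 : 0 ≤ r := hr.1
    have e : |v t r| ^ (α + 2) = (α + 2) * potential α (v t r) := by
      unfold potential
      field_simp
    have h1 : 0 ≤ r ^ m * v t r ^ 2 := by positivity
    have h2 : 0 ≤ r ^ (m + 2) * potential α (v t r) :=
      mul_nonneg (by positivity) (potential_nonneg hα _)
    simp only [G, S, e]
    nlinarith [mul_nonneg hm h1, mul_nonneg (mul_nonneg hm hm) h1]
  linarith

end HasSecondPartials

lemma hasFDerivAt_norm_of_ne_zero {E : Type*} [NormedAddCommGroup E] [InnerProductSpace ℝ E]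
    {x : E} (hx : x ≠ 0) : HasFDerivAt (fun y : E => ‖y‖) (‖x‖⁻¹ • innerSL ℝ x) x := by
  have hx' : ‖x‖ ≠ 0 := norm_ne_zero_iff.2 hx
  have h := (hasStrictFDerivAt_norm_sq x).hasFDerivAt.sqrt (by positivity)
  simp only [Real.sqrt_sq (norm_nonneg _)] at h
  refine h.congr_fderiv ?_
  ext y
  simp
  field_simp

section Radial

variable {d : ℕ} {f : Euc d → ℝ} {p p' p'' : ℝ → ℝ}

lemma hasFDerivAt_of_radial (hf : ∀ x, f x = p ‖x‖) (hp : ∀ r, HasDerivAt p (p' r) r) {x : Euc d}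
    (hx : x ≠ 0) : HasFDerivAt f (p' ‖x‖ • ‖x‖⁻¹ • innerSL ℝ x) x := by
  rw [funext hf]
  exact (hp ‖x‖).comp_hasFDerivAt x (hasFDerivAt_norm_of_ne_zero hx)

lemma norm_gradient_of_radial (hf : ∀ x, f x = p ‖x‖) (hp : ∀ r, HasDerivAt p (p' r) r)
    {x : Euc d} (hx : x ≠ 0) : ‖gradient f x‖ ^ 2 = p' ‖x‖ ^ 2 := by
  have hx' : ‖x‖ ≠ 0 := norm_ne_zero_iff.2 hx
  rw [gradient, LinearIsometryEquiv.norm_map, (hasFDerivAt_of_radial hf hp hx).fderiv, norm_smul,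
    norm_smul, innerSL_apply_norm, norm_inv, norm_norm, inv_mul_cancel₀ hx', mul_one,
    Real.norm_eq_abs, sq_abs]

lemma spatialLap_of_radial (hf : ∀ x, f x = p ‖x‖) (hp : ∀ r, HasDerivAt p (p' r) r)
    (hp' : ∀ r, HasDerivAt p' (p'' r) r) {x : Euc d} (hx : x ≠ 0) :
    spatialLap d f x = p'' ‖x‖ + ((d : ℝ) - 1) / ‖x‖ * p' ‖x‖ := by
  have hx' : ‖x‖ ≠ 0 := norm_ne_zero_iff.2 hx
  have second : ∀ i : Fin d,
      fderiv ℝ (fun y => fderiv ℝ f y (EuclideanSpace.single i 1)) x (EuclideanSpace.single i 1) =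
        p' ‖x‖ * ‖x‖⁻¹ + (p'' ‖x‖ * ‖x‖⁻¹ - p' ‖x‖ * (‖x‖ ^ 2)⁻¹) * ‖x‖⁻¹ * x i ^ 2 := by
    intro i
    have ev : (fun y => fderiv ℝ f y (EuclideanSpace.single i 1)) =ᶠ[nhds x]
        fun y => p' ‖y‖ * ‖y‖⁻¹ * y i := by
      filter_upwards [isOpen_ne.mem_nhds hx] with y hy
      rw [(hasFDerivAt_of_radial hf hp hy).fderiv]
      simp [EuclideanSpace.inner_single_right, mul_assoc]
    have hn := hasFDerivAt_norm_of_ne_zero hx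
    have h1 : HasFDerivAt (fun y : Euc d => p' ‖y‖ * ‖y‖⁻¹)
        ((p'' ‖x‖ * ‖x‖⁻¹ + p' ‖x‖ * (-(‖x‖ ^ 2)⁻¹)) • ‖x‖⁻¹ • innerSL ℝ x) x :=
      ((hp' ‖x‖).mul (hasDerivAt_inv hx')).comp_hasFDerivAt x hn
    have h2 : HasFDerivAt (fun y : Euc d => y i) (EuclideanSpace.proj i : Euc d →L[ℝ] ℝ) x :=
      (EuclideanSpace.proj i : Euc d →L[ℝ] ℝ).hasFDerivAt
    rw [ev.fderiv_eq,
      HasFDerivAt.fderiv (f := fun y : Euc d => p' ‖y‖ * ‖y‖⁻¹ * y i) (h1.mul h2)]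
    simp [EuclideanSpace.inner_single_right]
    ring
  have hsum : ∑ i, x i ^ 2 = ‖x‖ ^ 2 := (EuclideanSpace.real_norm_sq_eq x).symm
  rw [spatialLap, Finset.sum_congr rfl fun i _ => second i, Finset.sum_add_distrib,
    ← Finset.mul_sum _ _ (_ * _), hsum]
  simp only [Finset.sum_const, Finset.card_univ, Fintype.card_fin, nsmul_eq_mul]
  field_simp
  ring

end Radial

/-- Polar coordinates for the integral of a radial function. -/
lemma integral_radial {m : ℕ} {F G : ℝ → ℝ} {R : ℝ} (hR : 0 ≤ R) (cG : Continuous G)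
    (hFG : ∀ r, 0 < r → r ^ (m + 3) * F r = G r) (hG : ∀ r, R < r → G r = 0) :
    Integrable (fun x : Euc (m + 4) => F ‖x‖) ∧
      ∫ x : Euc (m + 4), F ‖x‖ =
        ((m + 4 : ℕ) * volume.real (Metric.ball (0 : Euc (m + 4)) 1)) *
          ∫ r in (0 : ℝ)..R, G r := by
  have hdim : Module.finrank ℝ (Euc (m + 4)) - 1 = m + 3 := by simp
  have h0 : ∀ r ∈ Ioi (0 : ℝ), r ^ (m + 3) • F r = G r := fun r hr => hFG r hr
  have h1 : ∀ r ∈ Ioi (0 : ℝ) \ Ioc 0 R, G r = 0 := fun r hr =>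
    hG r (not_le.1 fun h => hr.2 ⟨hr.1, h⟩)
  have hint : IntegrableOn G (Ioi 0) := by
    have h2 : IntegrableOn G (Ioc 0 R) := (cG.integrableOn_Icc).mono_set Ioc_subset_Icc_self
    exact h2.of_forall_sdiff_eq_zero measurableSet_Ioi h1
  constructor
  · rw [integrable_fun_norm_addHaar volume (f := F), hdim]
    exact (integrableOn_congr_fun h0 measurableSet_Ioi).2 hint
  · rw [integral_fun_norm_addHaar volume F, hdim, setIntegral_congr_fun measurableSet_Ioi h0,
      intervalIntegral.integral_of_le hR,
      setIntegral_eq_of_subset_of_forall_sdiff_eq_zero measurableSet_Ioi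
        (fun r hr => hr.1) h1]
    simp [mul_assoc]

/-- **Morawetz estimate** (Proposition 5.2). For `d ≥ 4`, a radial classical solution `u`
of the defocusing conformal NLW on `[0, T] × ℝ^d` satisfies
`∫_0^T ∫ [u²/|x|³ + |u|^{2(d+1)/(d−1)}/|x|] dx dt ≤ C(d) sup_{t∈[0,T]} ‖∇_{t,x}u(t)‖_{L²}²`. -/
theorem morawetz_estimate (d : ℕ) (hd : 4 ≤ d) :
    ∃ C : ℝ, 0 < C ∧
      ∀ (T : ℝ), 0 < T → ∀ u : ℝ → Euc d → ℝ,
        ContDiff ℝ (⊤ : ℕ∞) (Function.uncurry u) →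
        (∀ t, HasCompactSupport (u t)) →
        (∀ t, HasCompactSupport (fun x => timeDeriv d u t x)) →
        (∀ t ∈ Icc (0 : ℝ) T, IsRadial d (u t)) →
        (∀ t ∈ Icc (0 : ℝ) T, ∀ x, timeDeriv2 d u t x - spatialLap d (u t) x
            + |u t x| ^ ((4 : ℝ) / ((d : ℝ) - 1)) * u t x = 0) →
        (∫⁻ t in Icc (0 : ℝ) T, ∫⁻ x : Euc d,
            ENNReal.ofReal ((u t x) ^ 2 / ‖x‖ ^ 3 +
              |u t x| ^ (2 * ((d : ℝ) + 1) / ((d : ℝ) - 1)) / ‖x‖)) ≤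
          ENNReal.ofReal C *
            ⨆ t ∈ Icc (0 : ℝ) T, ENNReal.ofReal
              (∫ x : Euc d, (‖gradient (u t) x‖ ^ 2 + (timeDeriv d u t x) ^ 2)) := by
  obtain ⟨m, rfl⟩ : ∃ m, d = m + 4 := ⟨d - 4, by omega⟩
  refine ⟨2, two_pos, fun T hT u hu hsu hsut hrad hpde => ?_⟩
  have hm : (0 : ℝ) ≤ m := m.cast_nonneg
  have hd1 : ((m + 4 : ℕ) : ℝ) - 1 = m + 3 := by push_cast; ring
  have hexp : 2 * (((m + 4 : ℕ) : ℝ) + 1) / (((m + 4 : ℕ) : ℝ) - 1) = 4 / (m + 3) + 2 := by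
    rw [hd1]
    field_simp
    push_cast
    ring
  simp only [hexp]
  let e : Euc (m + 4) := EuclideanSpace.single 0 1
  have he : ‖e‖ = 1 := by simp [e]
  have hre : ∀ r : ℝ, 0 ≤ r → ‖r • e‖ = r := fun r hr => by
    rw [norm_smul, he, mul_one, Real.norm_of_nonneg hr]
  let v : ℝ → ℝ → ℝ := fun t r => u t (r • e)
  have hv : ContDiff ℝ (⊤ : ℕ∞) (Function.uncurry v) :=
    hu.comp (contDiff_fst.prodMk (contDiff_snd.smul contDiff_const))
  have H := hasSecondPartials_of_contDiff hv
  have huv : ∀ t ∈ Icc (0 : ℝ) T, ∀ x, u t x = v t ‖x‖ := fun t ht x => by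
    obtain ⟨g, hg⟩ := hrad t ht
    simp only [v]
    rw [hg, hg, hre _ (norm_nonneg x)]
  have huvt : ∀ t ∈ Icc (0 : ℝ) T, ∀ x, timeDeriv (m + 4) u t x = partialFst v t ‖x‖ :=
    fun t ht x => by
      have hdiff : DifferentiableAt ℝ (fun s => u s x) t :=
        ((hu.comp (contDiff_id.prodMk contDiff_const) :
          ContDiff ℝ (⊤ : ℕ∞) (fun s => u s x)).differentiable (by simp)) t
      exact deriv_eq_of_eqOn_Icc hT ht (fun s hs => huv s hs x) hdiff.hasDerivAt
        (H.deriv_t t ‖x‖)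
  have hpde' : ∀ t ∈ Icc 0 T, ∀ r, 0 < r →
      partialFst (partialFst v) t r - partialSnd (partialSnd v) t r -
        (m + 3) / r * partialSnd v t r + |v t r| ^ (4 / (m + 3) : ℝ) * v t r = 0 := by
    intro t ht r hr
    have hnorm := hre r hr.le
    have hne : r • e ≠ 0 := norm_ne_zero_iff.1 (by rw [hnorm]; exact hr.ne')
    have h := hpde t ht (r • e)
    rw [spatialLap_of_radial (huv t ht) (H.deriv_r t) (H.deriv_rr t) hne, hnorm, hd1] at h
    change partialFst (partialFst v) t r - _ + |v t r| ^ _ * v t r = 0 at h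
    linarith
  obtain ⟨R₁, hR₁, hu0⟩ := (hsu 0).exists_pos_le_norm
  obtain ⟨R₂, hR₂, hut0⟩ := (hsut 0).exists_pos_le_norm
  set R₀ := max R₁ R₂
  have hR₀pos : 0 < R₀ := lt_max_of_lt_left hR₁
  have hsupp : ∀ t ∈ Icc 0 T, ∀ r, R₀ + T < r → v t r = 0 := by
    intro t ht r hr
    refine H.eq_zero_of_initial_eq_zero (α := 4 / (m + 3)) (j := m + 2) (R := R₀) (T := T)
      (by positivity) hR₀pos.le ?_ (fun s hs => hu0 _ ?_) (fun s hs => hut0 (s • e) ?_) ht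
      (by linarith [ht.2])
    · intro t ht r hr
      have := hpde' t ht r hr
      push_cast
      rwa [show (m : ℝ) + 2 + 1 = m + 3 by ring]
    · rw [hre s (hR₀pos.trans hs).le]
      exact (le_max_left _ _).trans hs.le
    · rw [hre s (hR₀pos.trans hs).le]
      exact (le_max_right _ _).trans hs.le
  have hsupp_t : ∀ t ∈ Icc 0 T, ∀ r, R₀ + T < r → partialFst v t r = 0 := fun t ht r hr =>
    deriv_eq_of_eqOn_Icc hT ht (g := fun _ => 0) (fun s hs => hsupp s hs r hr) (H.deriv_t t r)
      (hasDerivAt_const t 0)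
  have hsupp_r : ∀ t ∈ Icc 0 T, ∀ r, R₀ + T < r → partialSnd v t r = 0 := fun t ht r hr => by
    have h1 : v t =ᶠ[nhds r] fun _ => 0 := by
      filter_upwards [lt_mem_nhds hr] with s hs using hsupp t ht s hs
    exact (H.deriv_r t r).unique ((hasDerivAt_const r 0).congr_of_eventuallyEq h1)
  set R := R₀ + T + 1
  have hRpos : 0 ≤ R := by linarith
  have morawetz := H.integral_morawetz_le hT hRpos (by linarith : R₀ + T < R) hpde' hsupp
  set c : ℝ := (m + 4 : ℕ) * volume.real (Metric.ball (0 : Euc (m + 4)) 1)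
  have hc0 : 0 ≤ c := by positivity
  have slice : ∀ {F : ℝ → ℝ → ℝ}, Continuous (Function.uncurry F) → ∀ t, Continuous (F t) :=
    fun hF t => hF.comp (by fun_prop : Continuous fun r : ℝ => (t, r))
  let N : ℝ → ℝ := fun t =>
    ∫ r in (0 : ℝ)..R, r ^ (m + 3) * (partialSnd v t r ^ 2 + partialFst v t r ^ 2)
  have kinetic : ∀ t ∈ Icc 0 T,
      ∫ x : Euc (m + 4), (‖gradient (u t) x‖ ^ 2 + timeDeriv (m + 4) u t x ^ 2) = c * N t := by
    intro t ht
    have hr := slice H.cont_r t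
    have ht' := slice H.cont_t t
    rw [← (integral_radial (F := fun r => partialSnd v t r ^ 2 + partialFst v t r ^ 2) hRpos
      (by fun_prop) (fun r _ => rfl) (fun r hr => by
        have hr' : R₀ + T < r := by linarith
        simp [hsupp_t t ht r hr', hsupp_r t ht r hr'])).2]
    refine integral_congr_ae ?_
    filter_upwards [compl_mem_ae_iff.2 (measure_singleton (0 : Euc (m + 4)))] with x hx
    rw [norm_gradient_of_radial (huv t ht) (H.deriv_r t) hx, huvt t ht x]
  let G : ℝ → ℝ → ℝ := fun t r =>
    r ^ m * v t r ^ 2 + r ^ (m + 2) * |v t r| ^ (4 / (m + 3) + 2 : ℝ)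
  have cG : Continuous (Function.uncurry G) := by
    have cV := H.cont
    have : Continuous fun p : ℝ × ℝ => |v p.1 p.2| ^ (4 / (m + 3) + 2 : ℝ) :=
      (continuous_abs.rpow_const fun _ => Or.inr (by positivity)).comp cV
    simp only [Function.uncurry_def, G] at *
    fun_prop
  have weighted : ∀ t ∈ Icc 0 T,
      ∫⁻ x : Euc (m + 4), ENNReal.ofReal
        (u t x ^ 2 / ‖x‖ ^ 3 + |u t x| ^ (4 / (m + 3) + 2 : ℝ) / ‖x‖) =
        ENNReal.ofReal (c * ∫ r in (0 : ℝ)..R, G t r) := by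
    intro t ht
    have h := integral_radial (m := m)
      (F := fun r => v t r ^ 2 / r ^ 3 + |v t r| ^ (4 / (m + 3) + 2 : ℝ) / r)
      hRpos (slice cG t) (fun r hr => by simp only [G]; field_simp; ring) (fun r hr => by
        have hr' : R₀ + T < r := by linarith
        have hq : (4 / (m + 3) + 2 : ℝ) ≠ 0 := by positivity
        simp [G, hsupp t ht r hr', Real.zero_rpow hq])
    rw [← h.2, ofReal_integral_eq_lintegral_ofReal h.1
      (Filter.Eventually.of_forall fun x => by positivity)]
    simp only [huv t ht]
  have cI : Continuous fun t => c * ∫ r in (0 : ℝ)..R, G t r :=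
    continuous_const.mul
      (intervalIntegral.continuous_parametric_intervalIntegral_of_continuous' cG 0 R)
  have lhs : ∫⁻ t in Icc (0 : ℝ) T, ENNReal.ofReal (c * ∫ r in (0 : ℝ)..R, G t r) =
      ENNReal.ofReal (c * ∫ t in (0 : ℝ)..T, ∫ r in (0 : ℝ)..R, G t r) := by
    rw [← ofReal_integral_eq_lintegral_ofReal cI.integrableOn_Icc
      (Filter.Eventually.of_forall fun t => mul_nonneg hc0
        (intervalIntegral.integral_nonneg hRpos fun r hr => by
          have := hr.1
          positivity)),
      integral_Icc_eq_integral_Ioc, ← intervalIntegral.integral_of_le hT.le,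
      intervalIntegral.integral_const_mul]
  rw [setLIntegral_congr_fun measurableSet_Icc weighted, lhs]
  have hN : ∀ t ∈ Icc 0 T, ENNReal.ofReal (c * N t) ≤ ⨆ t ∈ Icc (0 : ℝ) T, ENNReal.ofReal
      (∫ x : Euc (m + 4), (‖gradient (u t) x‖ ^ 2 + timeDeriv (m + 4) u t x ^ 2)) :=
    fun t ht => by
      rw [← kinetic t ht]
      exact le_iSup₂ (f := fun t (_ : t ∈ Icc (0 : ℝ) T) => ENNReal.ofReal
        (∫ x : Euc (m + 4), (‖gradient (u t) x‖ ^ 2 + timeDeriv (m + 4) u t x ^ 2))) t ht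
  calc ENNReal.ofReal (c * ∫ t in (0 : ℝ)..T, ∫ r in (0 : ℝ)..R, G t r)
      ≤ ENNReal.ofReal (c * N 0 + c * N T) := by
        rw [← mul_add]
        exact ENNReal.ofReal_le_ofReal (mul_le_mul_of_nonneg_left morawetz hc0)
    _ ≤ ENNReal.ofReal (c * N 0) + ENNReal.ofReal (c * N T) := ENNReal.ofReal_add_le
    _ ≤ _ := by
        rw [ENNReal.ofReal_ofNat, two_mul]
        exact add_le_add (hN 0 ⟨le_rfl, hT.le⟩) (hN T ⟨hT.le, le_rfl⟩)
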